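/- arXiv:0911.2441 — 4 statements merged into one kernel-verified Lean document; each statement's English description precedes it below -/
import Mathlib

section
/- For every integer k > 1 and every rational α that is not an integer and not a half-integer, \(\sum_{n=-\infty}^{+\infty} 1/(n+\alpha)^k\) equals π^k times a nonzero algebraic number. -/
lemma aux_hasDerivAt_cot (z : ℂ) (hz : Complex.sin (Real.pi * z) ≠ 0) :
    HasDerivAt (fun x : ℂ => Complex.cot (Real.pi * x))
      (-(Real.pi * (1 + Complex.cot (Real.pi * z) ^ 2))) z := by
  have hl : HasDerivAt (fun x : ℂ => (Real.pi : ℂ) * x) Real.pi z := by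
    simpa using (hasDerivAt_id z).const_mul (Real.pi : ℂ)
  have h := (hl.ccos).div (hl.csin) hz
  have e : (fun x : ℂ => Complex.cot (Real.pi * x)) =
    (fun x : ℂ => Complex.cos (Real.pi * x)) / (fun x : ℂ => Complex.sin (Real.pi * x)) := by
    ext x; simp [Complex.cot_eq_cos_div_sin]
  rw [e]
  refine h.congr_deriv ?_
  rw [Complex.cot_eq_cos_div_sin]
  field_simp
  ring

lemma aux_iter (k : ℕ) : ∃ P : Polynomial ℚ, ∀ z ∈ UpperHalfPlane.upperHalfPlaneSet,
    iteratedDerivWithin k (fun x : ℂ ↦ (Real.pi : ℂ) * Complex.cot (Real.pi * x))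
      UpperHalfPlane.upperHalfPlaneSet z =
      (Real.pi : ℂ) ^ (k + 1) * Polynomial.aeval (Complex.cot (Real.pi * z)) P := by
  induction k with
  | zero => exact ⟨Polynomial.X, fun z hz => by simp⟩
  | succ k ih =>
    obtain ⟨P, hP⟩ := ih
    refine ⟨-(1 + Polynomial.X ^ 2) * Polynomial.derivative P, fun z hz => ?_⟩
    rw [iteratedDerivWithin_succ, derivWithin_congr hP (hP z hz),
      derivWithin_of_isOpen UpperHalfPlane.isOpen_upperHalfPlaneSet hz]
    have h1 := aux_hasDerivAt_cot z
      (sin_pi_mul_ne_zero (UpperHalfPlane.coe_mem_integerComplement ⟨z, hz⟩))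
    have h2 := (P.hasDerivAt_aeval (Complex.cot (Real.pi * z))).comp z h1
    have h3 := h2.const_mul ((Real.pi : ℂ) ^ (k + 1))
    refine h3.deriv.trans ?_
    simp
    ring

lemma aux_summable (k : ℕ) (hk : 1 < k) (a : ℝ) :
    Summable (fun n : ℤ => 1 / |(n : ℝ) + a| ^ k) := by
  have := (Real.summable_one_div_int_add_rpow a (k : ℝ)).2 (by exact_mod_cast hk)
  simpa using this

lemma aux_summable' (k : ℕ) (hk : 1 < k) (a : ℝ) :
    Summable (fun n : ℤ => 1 / ((n : ℝ) + a) ^ k) := by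
  refine Summable.of_norm ?_
  simpa using aux_summable k hk a

open Filter Topology in
lemma aux_formula (k : ℕ) (hk : 1 ≤ k) (a : ℝ) (ha : ∀ n : ℤ, a ≠ n) :
    ∃ P : Polynomial ℚ, (-1 : ℝ) ^ k * k.factorial * ∑' n : ℤ, 1 / ((n : ℝ) + a) ^ (k + 1)
      = Real.pi ^ (k + 1) * Polynomial.aeval (Real.cot (Real.pi * a)) P := by
  obtain ⟨P, hP⟩ := aux_iter k
  refine ⟨P, ?_⟩
  let u : ℝ → ℂ := fun ε => (a : ℂ) + ε * Complex.I
  have hu : Tendsto u (𝓝[>] 0) (𝓝 (a : ℂ)) := by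
    have : Continuous u := by fun_prop
    have h := this.tendsto 0
    simp only [u, Complex.ofReal_zero, zero_mul, add_zero] at h
    exact h.mono_left nhdsWithin_le_nhds
  have hne : ∀ n : ℤ, (a : ℂ) + n ≠ 0 := by
    intro n h
    apply ha (-n)
    have h' : a + n = 0 := by exact_mod_cast h
    push_cast; linarith
  have hA : Tendsto (fun ε => ∑' n : ℤ, 1 / (u ε + n) ^ (k + 1)) (𝓝[>] 0)
      (𝓝 (∑' n : ℤ, 1 / ((a : ℂ) + n) ^ (k + 1))) := by
    refine tendsto_tsum_of_dominated_convergence (aux_summable (k + 1) (by omega) a) ?_ ?_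
    · intro n
      exact ((tendsto_const_nhds).div ((hu.add_const _).pow _) (pow_ne_zero _ (hne n)))
    · refine Eventually.of_forall fun ε n => ?_
      have hpos : 0 < |(n : ℝ) + a| := by
        rw [abs_pos]; intro h; apply hne n
        have : (a : ℝ) + n = 0 := by linarith
        exact_mod_cast this
      have hle : |(n : ℝ) + a| ≤ ‖u ε + n‖ := by
        have := Complex.abs_re_le_norm (u ε + n)
        simpa [u, add_comm] using this
      rw [norm_div, norm_pow, norm_one]
      gcongr
  have hmem : (a : ℂ) ∈ Complex.integerComplement := by
    rintro ⟨n, hn⟩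
    apply ha n
    exact_mod_cast hn.symm
  have hB : Tendsto (fun ε => (Real.pi : ℂ) ^ (k + 1) *
      Polynomial.aeval (Complex.cot (Real.pi * u ε)) P) (𝓝[>] 0)
      (𝓝 ((Real.pi : ℂ) ^ (k + 1) * Polynomial.aeval (Complex.cot (Real.pi * a)) P)) := by
    have h1 := (aux_hasDerivAt_cot a (sin_pi_mul_ne_zero hmem)).continuousAt.tendsto.comp hu
    have h2 := (P.continuous_aeval (A := ℂ)).tendsto (Complex.cot (Real.pi * a))
    exact (h2.comp h1).const_mul _
  have hEq : ∀ᶠ ε in 𝓝[>] (0 : ℝ), (-1 : ℂ) ^ k * k.factorial * ∑' n : ℤ, 1 / (u ε + n) ^ (k + 1)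
      = (Real.pi : ℂ) ^ (k + 1) * Polynomial.aeval (Complex.cot (Real.pi * u ε)) P := by
    filter_upwards [self_mem_nhdsWithin] with ε hε
    have hz : u ε ∈ UpperHalfPlane.upperHalfPlaneSet := by
      simpa [u, UpperHalfPlane.upperHalfPlaneSet] using hε
    rw [← hP _ hz, iteratedDerivWithin_cot_pi_mul_eq_mul_tsum_div_pow hk hz]
  have hfin := tendsto_nhds_unique ((hA.const_mul ((-1 : ℂ) ^ k * k.factorial)).congr' hEq) hB
  apply Complex.ofReal_injective
  have e : ((Polynomial.aeval (Real.cot (Real.pi * a)) P : ℝ) : ℂ) =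
      Polynomial.aeval (Complex.cot (Real.pi * a)) P := by
    rw [← Complex.ofReal_mul, ← Complex.ofReal_cot]
    exact (Polynomial.aeval_algebraMap_apply ℂ (Real.cot (Real.pi * a)) P).symm
  push_cast
  rw [e, ← hfin]
  simp only [add_comm]

lemma aux_alg_aeval (x : ℝ) (hx : IsAlgebraic ℚ x) (P : Polynomial ℚ) :
    IsAlgebraic ℚ (Polynomial.aeval x P) := by
  induction P using Polynomial.induction_on' with
  | add p q hp hq => rw [map_add]; exact hp.add hq
  | monomial n c =>
    rw [Polynomial.aeval_monomial]
    exact (isAlgebraic_algebraMap c).mul (hx.pow n)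

lemma aux_alg_cot (q : ℚ) : IsAlgebraic ℚ (Real.cot (Real.pi * q)) := by
  rw [Real.cot_eq_cos_div_sin, mul_comm, div_eq_mul_inv]
  have hinj : Function.Injective (algebraMap ℤ ℚ) := Int.cast_injective
  exact ((Real.isAlgebraic_cos_rat_mul_pi q).extendScalars hinj).mul
    ((Real.isAlgebraic_sin_rat_mul_pi q).extendScalars hinj).inv

lemma aux_ne_zero_odd (k : ℕ) (hk : 1 < k) (ho : Odd k) (x : ℝ) (h0 : 0 < x) (h1 : x < 1)
    (h2 : x ≠ 1 / 2) : ∑' n : ℤ, 1 / ((n : ℝ) + x) ^ k ≠ 0 := by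
  have hs := aux_summable' k hk x
  have hs1 : Summable fun n : ℕ => 1 / (((n : ℤ) : ℝ) + x) ^ k :=
    hs.comp_injective Nat.cast_injective
  have hs2 : Summable fun n : ℕ => 1 / (((-((n : ℤ) + 1) : ℤ) : ℝ) + x) ^ k :=
    hs.comp_injective (i := fun n : ℕ => -((n : ℤ) + 1)) (fun a b h => by
      simp only at h; omega)
  rw [tsum_of_nat_of_neg_add_one (f := fun n : ℤ => 1 / ((n : ℝ) + x) ^ k) hs1 hs2,
    ← hs1.tsum_add hs2]
  have hs3 := hs1.add hs2
  have key : ∀ n : ℕ, 1 / (((n : ℤ) : ℝ) + x) ^ k + 1 / (((-((n : ℤ) + 1) : ℤ) : ℝ) + x) ^ k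
      = 1 / ((n : ℝ) + x) ^ k - 1 / ((n : ℝ) + 1 - x) ^ k := by
    intro n
    have : (((-((n : ℤ) + 1) : ℤ) : ℝ) + x) = -((n : ℝ) + 1 - x) := by push_cast; ring
    rw [this, ho.neg_pow, div_neg]
    push_cast; ring
  simp only [key] at hs3 ⊢
  have hk0 : k ≠ 0 := by omega
  rcases lt_or_gt_of_ne h2 with h | h
  · have hp : ∀ n : ℕ, 0 < 1 / ((n : ℝ) + x) ^ k - 1 / ((n : ℝ) + 1 - x) ^ k := by
      intro n
      have hn : (0 : ℝ) ≤ n := n.cast_nonneg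
      rw [sub_pos]
      apply one_div_lt_one_div_of_lt (by positivity)
      exact pow_lt_pow_left₀ (by linarith) (by linarith) hk0
    exact (hs3.tsum_pos (fun n => (hp n).le) 0 (hp 0)).ne'
  · have hp : ∀ n : ℕ, 0 < -(1 / ((n : ℝ) + x) ^ k - 1 / ((n : ℝ) + 1 - x) ^ k) := by
      intro n
      have hn : (0 : ℝ) ≤ n := n.cast_nonneg
      rw [neg_sub, sub_pos]
      have : (0 : ℝ) < n + 1 - x := by linarith
      apply one_div_lt_one_div_of_lt (by positivity)
      exact pow_lt_pow_left₀ (by linarith) (by linarith) hk0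
    have := hs3.neg.tsum_pos (fun n => (hp n).le) 0 (hp 0)
    rw [tsum_neg] at this
    linarith

lemma aux_ne_zero (k : ℕ) (hk : 1 < k) (a : ℝ) (h1 : ∀ n : ℤ, a ≠ n)
    (h2 : ∀ n : ℤ, a ≠ n + 1 / 2) : ∑' n : ℤ, 1 / ((n : ℝ) + a) ^ k ≠ 0 := by
  rcases Nat.even_or_odd k with he | ho
  · have ha : a ≠ 0 := by simpa using h1 0
    refine ((aux_summable' k hk a).tsum_pos (fun n => ?_) 0 ?_).ne'
    · exact div_nonneg zero_le_one (he.pow_nonneg _)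
    · exact div_pos one_pos (he.pow_pos (by simpa using ha))
  · have h := aux_ne_zero_odd k hk ho (Int.fract a)
      (by rw [Int.fract_pos]; exact h1 _) (Int.fract_lt_one a)
      (by
        intro h
        apply h2 ⌊a⌋
        rw [← h, Int.floor_add_fract])
    rw [← (Equiv.addRight ⌊a⌋).tsum_eq] at h
    convert h using 5 with n
    have hf := Int.floor_add_fract a
    rw [Equiv.coe_addRight, Int.cast_add]
    linarith

open Real in
theorem stmt_8 (k : ℕ) (hk : 1 < k) (α : ℚ) (hα : ¬ ∃ m : ℤ, α = m)
    (hα2 : ¬ ∃ m : ℤ, α = m + 1/2) :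
    ∃ a : ℝ, IsAlgebraic ℚ a ∧ a ≠ 0 ∧
      ∑' n : ℤ, 1 / ((n : ℝ) + (α : ℝ))^k = π^k * a := by
  have h1 : ∀ n : ℤ, (α : ℝ) ≠ n := fun n h => hα ⟨n, by exact_mod_cast h⟩
  have h2 : ∀ n : ℤ, (α : ℝ) ≠ n + 1 / 2 := fun n h => hα2 ⟨n, by
    have : (α : ℝ) = ((n + 1 / 2 : ℚ) : ℝ) := by rw [h]; push_cast; ring
    exact_mod_cast this⟩
  have hne := aux_ne_zero k hk α h1 h2
  obtain ⟨m, rfl⟩ : ∃ m, k = m + 1 := ⟨k - 1, by omega⟩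
  obtain ⟨P, hP⟩ := aux_formula m (by omega) α h1
  set S := ∑' n : ℤ, 1 / ((n : ℝ) + (α : ℝ))^(m + 1) with hS
  have hc : ((-1 : ℝ) ^ m * m.factorial) ≠ 0 := by positivity
  have hSe : S = π ^ (m + 1) *
      (((-1 : ℝ) ^ m * m.factorial)⁻¹ * Polynomial.aeval (Real.cot (Real.pi * α)) P) := by
    rw [mul_left_comm, ← hP, inv_mul_cancel_left₀ hc]
  refine ⟨_, ?_, ?_, hSe⟩
  · refine IsAlgebraic.mul ?_ (aux_alg_aeval _ (aux_alg_cot α) P)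
    have := isAlgebraic_algebraMap (R := ℚ) (A := ℝ) (((-1 : ℚ) ^ m * m.factorial)⁻¹)
    simpa using this
  · intro h
    rw [h, mul_zero] at hSe
    exact hne hSe
end

section
/- For every integer k > 1 and every rational α ∉ ℤ, the number \(\sum_{n=-\infty}^{+\infty} 1/(n+\alpha)^k\) is either zero or transcendental, and it is zero if and only if k is odd and α is a half-integer. -/
open Polynomial

lemma subs_map {K L : Type*} [AddCommMonoid K] [AddCommMonoid L] (σ : K →+ L) (B : Multiset K) :
    (B.powerset.map Multiset.sum).map σ = (B.map σ).powerset.map Multiset.sum := by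
  induction B using Multiset.induction with
  | empty => simp
  | cons a s ih =>
    simp only [Multiset.powerset_cons, Multiset.map_add, Multiset.map_cons, Multiset.map_map, Function.comp_def, Multiset.sum_cons, map_add] at ih ⊢
    rw [ih]
    have := congrArg (Multiset.map (fun x => σ a + x)) ih
    simp only [Multiset.map_map, Function.comp_def] at this
    rw [this]

lemma subs_exp (B : Multiset ℂ) :
    ((B.powerset.map Multiset.sum).map Complex.exp).sum = (B.map (fun b => 1 + Complex.exp b)).prod := by
  induction B using Multiset.induction with
  | empty => simp
  | cons a s ih =>
    simp only [Multiset.powerset_cons, Multiset.map_add, Multiset.map_cons, Multiset.map_map, Function.comp_def, Multiset.sum_cons, Multiset.sum_add, Multiset.prod_cons, Complex.exp_add, Multiset.sum_map_mul_left] at ih ⊢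
    rw [ih]; ring

lemma int_aux {K : Type*} [Field K] [CharZero K] (a : ℤ) (x : K) (h : IsIntegral ℤ ((a : K) * x))
    (g : ℤ[X]) (N : ℕ) (hg : g.natDegree ≤ N) : IsIntegral ℤ ((a : K) ^ N * aeval x g) := by
  rw [aeval_eq_sum_range, Finset.mul_sum]
  refine IsIntegral.sum _ fun i hi => ?_
  have hi' : i ≤ N := by have := Finset.mem_range.1 hi; omega
  have : (a : K) ^ N * g.coeff i • x ^ i
      = ((g.coeff i * a ^ (N - i) : ℤ) : K) * ((a : K) * x) ^ i := by
    rw [← Nat.sub_add_cancel hi', pow_add, zsmul_eq_mul]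
    push_cast
    rw [Nat.add_sub_cancel]
    ring
  rw [this]
  exact IsIntegral.mul (isIntegral_algebraMap (R := ℤ) (A := K)) (h.pow i)

lemma core {K : Type*} [Field K] [CharZero K] [Algebra ℚ K] [IsGalois ℚ K] (φ : K →ₐ[ℚ] ℂ)
    (M : Multiset K) (hM : ∀ σ : Gal(K/ℚ), M.map σ = M) (h0 : (0 : K) ∉ M) (m : ℕ) (hm : m ≠ 0) :
    (m : ℂ) + (M.map (fun x => Complex.exp (φ x))).sum ≠ 0 := by
  intro hsum
  set F : K[X] := (M.map (fun a => X - C a)).prod with hF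
  have hF0 : F ≠ 0 := by
    rw [hF]; exact (monic_multiset_prod_of_monic _ _ fun a _ => monic_X_sub_C a).ne_zero
  have hFσ : ∀ σ : Gal(K/ℚ), F.map (σ : K →+* K) = F := by
    intro σ
    rw [hF, Polynomial.map_multiset_prod, Multiset.map_map]
    conv_rhs => rw [← hM σ, Multiset.map_map]
    simp
  have hlift : F ∈ lifts (algebraMap ℚ K) := by
    rw [lifts_iff_coeff_lifts]
    intro n
    rw [InfiniteGalois.mem_range_algebraMap_iff_fixed]
    intro σ
    conv_rhs => rw [← hFσ σ]
    simp
  obtain ⟨q, hq⟩ := (mem_lifts _).1 hlift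
  obtain ⟨b, hb, hbq⟩ := IsLocalization.integerNormalization_spec (nonZeroDivisors ℤ) q
  set f := IsLocalization.integerNormalization (nonZeroDivisors ℤ) q
  have hb0 : b ≠ 0 := nonZeroDivisors.ne_zero hb
  have hfK : f.map (algebraMap ℤ K) = C (b : K) * F := by
    rw [← hq, IsScalarTower.algebraMap_eq ℤ ℚ K, ← Polynomial.map_map, hbq]
    ext n; simp
  have hev : ∀ x : K, aeval x f = b * F.eval x := by
    intro x
    rw [aeval_def, ← eval_map, hfK]; simp
  have hroot : ∀ x : K, aeval x f = 0 ↔ x ∈ M := by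
    intro x
    rw [hev, mul_eq_zero, or_iff_right (by exact_mod_cast hb0), ← IsRoot.def, ← mem_roots hF0, hF,
      roots_multiset_prod_X_sub_C]
  have hf0 : f ≠ 0 := by
    intro h
    rw [h, Polynomial.map_zero] at hfK
    exact (mul_ne_zero (C_ne_zero.2 (by exact_mod_cast hb0)) hF0) hfK.symm
  have hfe : f.eval 0 ≠ 0 := by
    intro h
    apply h0
    rw [← hroot, aeval_def, eval₂_at_zero, coeff_zero_eq_eval_zero, h, map_zero]
  obtain ⟨c, hc⟩ := LindemannWeierstrass.exp_polynomial_approx f hfe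
  set a := f.leadingCoeff
  set d := f.natDegree
  have ha : a ≠ 0 := leadingCoeff_ne_zero.2 hf0
  set A : ℝ := |(a : ℝ)| ^ d * c with hA
  have hlim : Filter.Tendsto (fun p : ℕ => (M.card : ℝ) * A * (A ^ p / p.factorial)) Filter.atTop (nhds 0) := by
    simpa using (FloorSemiring.tendsto_pow_div_factorial_atTop A).const_mul ((M.card : ℝ) * A)
  obtain ⟨P0, hP0⟩ := Filter.eventually_atTop.1 (hlim.eventually (gt_mem_nhds zero_lt_one))
  obtain ⟨p, hp, hpp⟩ := Nat.exists_infinite_primes (P0 + 1 + (f.eval 0).natAbs + 1 + a.natAbs + 1 + m + 1)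
  obtain ⟨n, hn, g, hg, hr⟩ := hc p (by omega) hpp
  have hp1 := hP0 (p - 1) (by omega)
  have hrat : ∃ z : ℤ, (z : K) = (M.map (fun x => (a : K) ^ (p * d) * aeval x g)).sum := by
    have h1 : IsIntegral ℤ (M.map (fun x => (a : K) ^ (p * d) * aeval x g)).sum := by
      refine IsIntegral.multiset_sum ?_
      intro y hy
      obtain ⟨x, hx, rfl⟩ := Multiset.mem_map.1 hy
      refine int_aux a x ?_ g _ (by omega)
      have := isIntegral_leadingCoeff_smul f x ((hroot x).2 hx)
      simpa [zsmul_eq_mul] using this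
    have h2 : (M.map (fun x => (a : K) ^ (p * d) * aeval x g)).sum ∈ Set.range (algebraMap ℚ K) := by
      rw [InfiniteGalois.mem_range_algebraMap_iff_fixed]
      intro σ
      conv_rhs => rw [← hM σ]
      rw [map_multiset_sum, Multiset.map_map, Multiset.map_map]
      congr 1
      refine Multiset.map_congr rfl fun x _ => ?_
      simp only [Function.comp_apply, map_mul, map_pow, map_intCast]
      congr 1
      exact (aeval_algHom_apply ((σ : K →ₐ[ℚ] K).restrictScalars ℤ) x g).symm
    obtain ⟨r, hr⟩ := h2
    rw [← hr, isIntegral_algebraMap_iff (algebraMap ℚ K).injective,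
      IsIntegrallyClosed.isIntegral_iff] at h1
    obtain ⟨y, hy⟩ := h1
    exact ⟨y, by rw [← hr, ← hy]; simp⟩
  obtain ⟨z, hz⟩ := hrat
  have hzC : (z : ℂ) = (M.map (fun x => (a : ℂ) ^ (p * d) * aeval (φ x) g)).sum := by
    have := congrArg φ hz
    rw [map_multiset_sum, Multiset.map_map, map_intCast] at this
    rw [this]
    congr 1
    refine Multiset.map_congr rfl fun x _ => ?_
    simp only [Function.comp_apply, map_mul, map_pow, map_intCast]
    congr 1
    exact (aeval_algHom_apply (φ.restrictScalars ℤ) x g).symm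
  set E : Multiset ℂ := M.map (fun x => (a : ℂ) ^ (p * d) * (n • Complex.exp (φ x) - p • aeval (φ x) g)) with hE
  have hid : ((a ^ (p * d) * n * m + p * z : ℤ) : ℂ) = - E.sum := by
    have : E.sum = (a : ℂ) ^ (p * d) * n * (M.map (fun x => Complex.exp (φ x))).sum - p * z := by
      rw [hzC, ← Multiset.sum_map_mul_left, ← Multiset.sum_map_mul_left, ← Multiset.sum_map_sub]
      rw [hE]
      congr 1
      refine Multiset.map_congr rfl fun x _ => ?_
      simp only [zsmul_eq_mul, nsmul_eq_mul]
      ring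
    rw [this]
    push_cast
    linear_combination (a : ℂ) ^ (p * d) * n * hsum
  have hbound : ‖E.sum‖ ≤ (M.card : ℝ) * (|(a : ℝ)| ^ (p * d) * (c ^ p / (p - 1).factorial)) := by
    refine (norm_multiset_sum_le _).trans ?_
    refine (Multiset.sum_le_card_nsmul _ (|(a : ℝ)| ^ (p * d) * (c ^ p / (p - 1).factorial)) ?_).trans ?_
    · intro y hy
      obtain ⟨w, hw, rfl⟩ := Multiset.mem_map.1 hy
      obtain ⟨x, hx, rfl⟩ := Multiset.mem_map.1 hw
      rw [norm_mul, norm_pow, Complex.norm_intCast]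
      gcongr
      apply hr
      rw [mem_aroots]
      refine ⟨hf0, ?_⟩
      have := aeval_algHom_apply (φ.restrictScalars ℤ) x f
      rw [(hroot x).2 hx, map_zero] at this
      exact this
    · simp [hE, nsmul_eq_mul]
  have hlt : ‖E.sum‖ < 1 := by
    refine hbound.trans_lt (lt_of_eq_of_lt ?_ hp1)
    obtain ⟨p', rfl⟩ : ∃ p', p = p' + 1 := ⟨p - 1, by omega⟩
    simp only [Nat.add_sub_cancel, hA]
    rw [mul_comm (p' + 1) d, pow_mul, mul_pow, pow_succ, pow_succ]
    ring
  have hzero : a ^ (p * d) * n * m + p * z = 0 := by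
    rw [← Int.abs_lt_one_iff]
    have : ‖((a ^ (p * d) * n * m + p * z : ℤ) : ℂ)‖ < 1 := by rw [hid, norm_neg]; exact hlt
    rw [Complex.norm_intCast] at this
    exact_mod_cast this
  have hdvd : (p : ℤ) ∣ a ^ (p * d) * n * m := ⟨-z, by linear_combination hzero⟩
  have hpI := Nat.prime_iff_prime_int.1 hpp
  rcases hpI.dvd_or_dvd hdvd with h | h
  · rcases hpI.dvd_or_dvd h with h | h
    · have := Int.natAbs_dvd_natAbs.2 (hpI.dvd_of_dvd_pow h)
      have := Nat.le_of_dvd (by omega) this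
      simp at this
      omega
    · exact hn h
  · have := Nat.le_of_dvd (by omega) (Int.natCast_dvd_natCast.1 h)
    omega

lemma transcendental_pi_aux : Transcendental ℚ Real.pi := by
  intro halg
  have hC : IsAlgebraic ℚ ((Real.pi : ℂ) * Complex.I) := by
    refine IsAlgebraic.mul ?_ ?_
    · exact halg.algebraMap (A := ℂ)
    · exact IsIntegral.isAlgebraic ⟨X ^ 2 + 1, by monicity!, by simp⟩
  let K := algebraicClosure ℚ ℂ
  have : IsAlgClosure ℚ K := algebraicClosure.isAlgClosure ℚ ℂ
  have : IsGalois ℚ K := IsAlgClosure.isGalois ℚ K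
  have : IsAlgClosed K := IsAlgClosure.isAlgClosed ℚ
  let φ : K →ₐ[ℚ] ℂ := K.val
  let w : K := ⟨(Real.pi : ℂ) * Complex.I, mem_algebraicClosure_iff.2 hC⟩
  have hw : IsIntegral ℚ w := (Algebra.IsAlgebraic.isAlgebraic (R := ℚ) w).isIntegral
  set q := minpoly ℚ w
  set B : Multiset K := q.aroots K with hBdef
  have hwB : w ∈ B := by
    rw [mem_aroots]; exact ⟨minpoly.ne_zero hw, minpoly.aeval _ _⟩
  have hB : ∀ σ : Gal(K/ℚ), B.map σ = B := by
    intro σ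
    have hs : (q.map (algebraMap ℚ K)).Splits := IsAlgClosed.splits _
    have := hs.roots_map (σ : K →+* K)
    rw [Polynomial.map_map] at this
    have h2 : (σ : K →+* K).comp (algebraMap ℚ K) = algebraMap ℚ K := RingHom.ext fun x => σ.commutes x
    rw [h2] at this
    exact this.symm
  set T := B.powerset.map Multiset.sum with hT
  have hTσ : ∀ σ : Gal(K/ℚ), T.map σ = T := by
    intro σ
    have := subs_map (σ : K →+ K) B
    have h3 : B.map (σ : K →+ K) = B := hB σ
    rw [h3] at this
    exact this
  have hexp : (T.map (fun x => Complex.exp (φ x))).sum = 0 := by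
    have h1 := subs_map (φ : K →+ ℂ) B
    have h2 := subs_exp (B.map (φ : K →+ ℂ))
    rw [← h1, Multiset.map_map] at h2
    have : (T.map (fun x => Complex.exp (φ x))).sum = _ := h2
    rw [this]
    apply Multiset.prod_eq_zero
    rw [Multiset.map_map, Multiset.mem_map]
    refine ⟨w, hwB, ?_⟩
    have : φ w = (Real.pi : ℂ) * Complex.I := rfl
    simp [this, Complex.exp_pi_mul_I]
  classical
  set M := T.filter (fun x => x ≠ 0) with hMdef
  set Z := T.filter (fun x => ¬ (x ≠ 0)) with hZ
  have hTMZ : M + Z = T := Multiset.filter_add_not _ _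
  have h0 : (0 : K) ∈ T := Multiset.mem_map.2 ⟨0, by simp, by simp⟩
  have hZc : Z.card ≠ 0 := by
    rw [Multiset.card_eq_zero.ne]
    intro h
    have : (0 : K) ∈ Z := Multiset.mem_filter.2 ⟨h0, by simp⟩
    rw [h] at this; simp at this
  refine core φ M ?_ (by simp [hMdef]) Z.card hZc ?_
  · intro σ
    rw [hMdef]
    conv_rhs => rw [← hTσ σ, Multiset.filter_map]
    congr 1
    refine Multiset.filter_congr fun x _ => ?_
    simp
  · rw [← hTMZ, Multiset.map_add, Multiset.sum_add] at hexp
    rw [add_comm, ← hexp]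
    congr 1
    have : Z.map (fun x => Complex.exp (φ x)) = Z.map (fun _ => (1 : ℂ)) := by
      refine Multiset.map_congr rfl fun x hx => ?_
      have : x = 0 := by simpa using (Multiset.mem_filter.1 hx).2
      simp [this]
    rw [this]; simp

lemma char_sum (q : ℕ) (hq : 0 < q) (c : ℤ) :
    ∑ j ∈ Finset.range q, Complex.exp (2 * Real.pi * Complex.I * c * (j / q : ℝ))
      = if (q : ℤ) ∣ c then (q : ℂ) else 0 := by
  have hq0 : (q : ℂ) ≠ 0 := by exact_mod_cast hq.ne'
  have h2 : (2 * Real.pi * Complex.I : ℂ) ≠ 0 := Complex.two_pi_I_ne_zero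
  set ζ := Complex.exp (2 * Real.pi * Complex.I * (c / q)) with hζ
  have hpow : ∀ j : ℕ, Complex.exp (2 * Real.pi * Complex.I * c * (j / q : ℝ)) = ζ ^ j := by
    intro j
    rw [hζ, ← Complex.exp_nat_mul]
    congr 1
    push_cast
    ring
  simp_rw [hpow]
  have hζq : ζ ^ q = 1 := by
    rw [hζ, ← Complex.exp_nat_mul, Complex.exp_eq_one_iff]
    exact ⟨c, by field_simp⟩
  split_ifs with h
  · obtain ⟨d, rfl⟩ := h
    have : ζ = 1 := by
      rw [hζ, Complex.exp_eq_one_iff]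
      exact ⟨d, by push_cast; field_simp⟩
    simp [this]
  · have : ζ ≠ 1 := by
      rw [hζ, Ne, Complex.exp_eq_one_iff]
      rintro ⟨d, hd⟩
      apply h
      refine ⟨d, ?_⟩
      have : (c : ℂ) / q = d := by
        apply mul_left_cancel₀ h2
        rw [hd]; ring
      rw [div_eq_iff hq0] at this
      have h3 : c = d * q := by exact_mod_cast this
      rw [h3]; ring
    rw [geom_sum_eq this, hζq]; simp

lemma alg_exp (q : ℕ) (hq : 0 < q) (c : ℤ) (j : ℕ) :
    IsAlgebraic ℚ (Complex.exp (2 * Real.pi * Complex.I * c * (j / q : ℝ))) := by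
  have hq0 : (q : ℂ) ≠ 0 := by exact_mod_cast hq.ne'
  refine IsAlgebraic.of_pow hq ?_
  have : Complex.exp (2 * Real.pi * Complex.I * c * (j / q : ℝ)) ^ q = 1 := by
    rw [← Complex.exp_nat_mul, Complex.exp_eq_one_iff]
    exact ⟨c * j, by push_cast; field_simp⟩
  rw [this]; exact isAlgebraic_one

lemma sum_eq (k : ℕ) (hk : 1 < k) (α : ℚ) :
    ∃ A : ℂ, IsAlgebraic ℚ A ∧
      HasSum (fun n : ℤ => ((1 / ((n : ℝ) + (α : ℝ)) ^ k : ℝ) : ℂ)) ((Real.pi : ℂ) ^ k * A) := by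
  set q := α.den with hqd
  set a := α.num with had
  have hq : 0 < q := α.den_pos
  have hq0 : (q : ℂ) ≠ 0 := by exact_mod_cast hq.ne'
  have hα : (α : ℝ) = a / q := by exact_mod_cast (Rat.num_div_den α).symm
  have hj : ∀ j ∈ Finset.range q, HasSum (fun n : ℤ =>
      Complex.exp (2 * Real.pi * Complex.I * (-a : ℤ) * (j / q : ℝ)) *
        (1 / (n : ℂ) ^ k * Complex.exp (2 * Real.pi * Complex.I * n * (j / q : ℝ))))
      (Complex.exp (2 * Real.pi * Complex.I * (-a : ℤ) * (j / q : ℝ)) *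
        (-(2 * Real.pi * Complex.I) ^ k / k.factorial * bernoulliFun k (j / q : ℝ))) := by
    intro j hj
    have hjq : (j : ℝ) / q ∈ Set.Icc (0 : ℝ) 1 := by
      refine ⟨by positivity, div_le_one_of_le₀ ?_ (by positivity)⟩
      exact_mod_cast (Finset.mem_range.1 hj).le
    have := (hasSum_one_div_pow_mul_fourier_mul_bernoulliFun hk hjq)
    simp only [fourier_coe_apply, Complex.ofReal_one, div_one] at this
    exact this.mul_left _
  have hs := hasSum_sum hj
  have hfun : ∀ n : ℤ, (∑ j ∈ Finset.range q,
      Complex.exp (2 * Real.pi * Complex.I * (-a : ℤ) * (j / q : ℝ)) *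
        (1 / (n : ℂ) ^ k * Complex.exp (2 * Real.pi * Complex.I * n * (j / q : ℝ))))
      = 1 / (n : ℂ) ^ k * if (q : ℤ) ∣ n - a then (q : ℂ) else 0 := by
    intro n
    rw [← char_sum q hq, Finset.mul_sum]
    refine Finset.sum_congr rfl fun j _ => ?_
    have : (2 * Real.pi * Complex.I * ((n - a : ℤ) : ℂ) * (j / q : ℝ) : ℂ)
      = 2 * Real.pi * Complex.I * ((-a : ℤ) : ℂ) * (j / q : ℝ) + 2 * Real.pi * Complex.I * n * (j / q : ℝ) := by
      push_cast; ring
    rw [this, Complex.exp_add]; ring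
  simp_rw [hfun] at hs
  have hinj : Function.Injective (fun m : ℤ => a + q * m) := by
    intro x y h
    have hq' : (q : ℤ) ≠ 0 := by exact_mod_cast hq.ne'
    exact mul_left_cancel₀ hq' (add_left_cancel h)
  rw [← hinj.hasSum_iff] at hs
  swap
  · intro n hn
    rw [if_neg, mul_zero]
    rintro ⟨d, hd⟩
    exact hn ⟨d, by simp only; linarith⟩
  have hs2 := hs.mul_left ((q : ℂ) ^ k / q)
  refine ⟨(q : ℂ) ^ k / q * ∑ j ∈ Finset.range q,
    (Complex.exp (2 * Real.pi * Complex.I * (-a : ℤ) * (j / q : ℝ)) *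
        (-(2 * Complex.I) ^ k / k.factorial * bernoulliFun k (j / q : ℝ))), ?_, ?_⟩
  · have hnat : ∀ n : ℕ, IsAlgebraic ℚ (n : ℂ) := fun n => isAlgebraic_natCast n
    refine IsAlgebraic.mul ?_ (mem_algebraicClosure_iff.1 (sum_mem fun j _ => mem_algebraicClosure_iff.2 ?_))
    · rw [div_eq_mul_inv]
      exact ((hnat q).pow k).mul (hnat q).inv
    · refine (alg_exp q hq _ j).mul (IsAlgebraic.mul ?_ ?_)
      · rw [div_eq_mul_inv]
        refine IsAlgebraic.mul (IsAlgebraic.neg (IsAlgebraic.pow (IsAlgebraic.mul ?_ ?_) k)) (hnat _).inv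
        · exact_mod_cast hnat 2
        · exact IsIntegral.isAlgebraic ⟨X ^ 2 + 1, by monicity!, by simp⟩
      · have : bernoulliFun k (j / q : ℝ) = (((Polynomial.bernoulli k).eval (j / q : ℚ) : ℚ) : ℝ) := by
          have h := Polynomial.eval_map_algebraMap (B := ℝ) (Polynomial.bernoulli k) ((j : ℝ) / q)
          have h' := Polynomial.aeval_algebraMap_apply ℝ ((j : ℚ) / q) (Polynomial.bernoulli k)
          rw [bernoulliFun, h]
          simpa using h'
        rw [this]
        exact isAlgebraic_algebraMap (A := ℂ) ((Polynomial.bernoulli k).eval (j / q : ℚ))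
  · convert! hs2 using 1
    · funext m
      simp only [Function.comp_apply]
      rw [if_pos ⟨m, by ring⟩, hα]
      have : (((m : ℝ) + a / q : ℝ) : ℂ) = ((a + q * m : ℤ) : ℂ) / q := by
        push_cast; field_simp; ring
      rw [Complex.ofReal_div, Complex.ofReal_pow, this, div_pow, Complex.ofReal_one, one_div_div]
      field_simp
    · rw [Finset.mul_sum, Finset.mul_sum, Finset.mul_sum]
      refine Finset.sum_congr rfl fun j _ => ?_
      rw [mul_pow, mul_pow, mul_pow]; ring

lemma inv_pow_lt (k : ℕ) (hk : Odd k) (u v : ℝ) (huv : u < v) (h : 0 < u * v) :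
    1 / v ^ k < 1 / u ^ k := by
  have : v⁻¹ < u⁻¹ := by
    have hu : u ≠ 0 := by rintro rfl; simp at h
    have hv : v ≠ 0 := by rintro rfl; simp at h
    have : u⁻¹ - v⁻¹ = (v - u) / (u * v) := by field_simp
    have h2 : 0 < (v - u) / (u * v) := div_pos (by linarith) h
    linarith
  have := hk.strictMono_pow this
  simpa [one_div, inv_pow] using this

lemma sign_aux (x : ℤ) (t : ℝ) (h0 : 0 < t) (h1 : t < 1) : 0 < (x + t) * (x + 1 - t) := by
  rcases le_or_gt 0 x with h | h
  · have : (0 : ℝ) ≤ x := by exact_mod_cast h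
    exact mul_pos (by linarith) (by linarith)
  · have : (x : ℝ) ≤ -1 := by exact_mod_cast (by omega : x ≤ -1)
    exact mul_pos_of_neg_of_neg (by linarith) (by linarith)

theorem stmt_9 (k : ℕ) (hk : 1 < k) (α : ℚ) (hα : ¬ ∃ m : ℤ, α = m) :
    ((∑' n : ℤ, 1 / ((n : ℝ) + (α : ℝ))^k) = 0 ∨
      Transcendental ℚ (∑' n : ℤ, 1 / ((n : ℝ) + (α : ℝ))^k)) ∧
    ((∑' n : ℤ, 1 / ((n : ℝ) + (α : ℝ))^k) = 0 ↔ Odd k ∧ ∃ m : ℤ, α = m + 1/2) := by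
  obtain ⟨A, hA, hsum⟩ := sum_eq k hk α
  have hS : Summable (fun n : ℤ => 1 / ((n : ℝ) + (α : ℝ)) ^ k) :=
    Complex.summable_ofReal.1 hsum.summable
  have hval : ((∑' n : ℤ, 1 / ((n : ℝ) + (α : ℝ)) ^ k : ℝ) : ℂ) = (Real.pi : ℂ) ^ k * A := by
    rw [Complex.ofReal_tsum]; exact hsum.tsum_eq
  set S := ∑' n : ℤ, 1 / ((n : ℝ) + (α : ℝ)) ^ k with hSdef
  set f : ℤ → ℝ := fun n => 1 / ((n : ℝ) + (α : ℝ)) ^ k with hf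
  have hne : ∀ n : ℤ, (n : ℝ) + α ≠ 0 := by
    intro n h
    refine hα ⟨-n, ?_⟩
    have : (n : ℚ) + α = 0 := by exact_mod_cast h
    push_cast; linarith
  constructor
  · by_cases h0 : S = 0
    · exact Or.inl h0
    · right
      intro halg
      have hSC : IsAlgebraic ℚ (S : ℂ) := halg.algebraMap (A := ℂ)
      have hA0 : A ≠ 0 := by
        rintro rfl
        rw [mul_zero] at hval
        exact h0 (by exact_mod_cast hval)
      have hpk : IsAlgebraic ℚ ((Real.pi : ℂ) ^ k) := by
        have : (Real.pi : ℂ) ^ k = S * A⁻¹ := by rw [hval]; field_simp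
        rw [this]; exact hSC.mul hA.inv
      have hp : IsAlgebraic ℚ (algebraMap ℝ ℂ Real.pi) := IsAlgebraic.of_pow (by omega) hpk
      exact transcendental_pi_aux ((isAlgebraic_algebraMap_iff (algebraMap ℝ ℂ).injective).1 hp)
  · rcases Nat.even_or_odd k with he | ho
    · have : 0 < S := hS.tsum_pos (fun n => one_div_nonneg.2 (he.pow_nonneg _)) 0
        (one_div_pos.2 (he.pow_pos (hne 0)))
      constructor
      · intro h; exact absurd h this.ne'
      · rintro ⟨h, _⟩; exact absurd he (Nat.not_even_iff_odd.2 h)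
    · constructor
      · intro h0
        refine ⟨ho, ?_⟩
        by_contra hhalf
        set N := ⌊α⌋ with hN
        have ht0 : (0 : ℝ) < (α : ℝ) - N := by
          have h1 : (N : ℚ) ≤ α := Int.floor_le α
          have h2 : (N : ℚ) ≠ α := fun h => hα ⟨N, h.symm⟩
          have h3 : (N : ℝ) < α := by exact_mod_cast lt_of_le_of_ne h1 h2
          linarith
        have ht1 : (α : ℝ) - N < 1 := by
          have h1 : α < N + 1 := Int.lt_floor_add_one α
          have h3 : (α : ℝ) < N + 1 := by exact_mod_cast h1
          linarith
        have hth : (α : ℝ) - N ≠ 1 / 2 := by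
          intro h
          refine hhalf ⟨N, ?_⟩
          have : (α : ℝ) = ((N + 1 / 2 : ℚ) : ℝ) := by push_cast; linarith
          exact_mod_cast this
        let e : ℤ ≃ ℤ := Equiv.subLeft (-1 - 2 * N)
        have he1 : Summable (fun n => f (e n)) := (e.summable_iff (f := f)).2 hS
        have he2 : ∑' n, f (e n) = S := e.tsum_eq f
        have hadd : ∑' n, (f n + f (e n)) = 0 := by
          rw [hS.tsum_add he1, he2]
          change S + S = 0
          rw [h0, add_zero]
        have hg : ∀ n : ℤ, f n + f (e n)
            = 1 / ((n : ℝ) + α) ^ k - 1 / ((n : ℝ) + 2 * N + 1 - α) ^ k := by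
          intro n
          have h1 : ((e n : ℤ) : ℝ) + α = -((n : ℝ) + 2 * N + 1 - α) := by
            simp only [e, Equiv.subLeft_apply]; push_cast; ring
          simp only [hf]
          rw [h1, ho.neg_pow, div_neg]; ring
        have hsg : ∀ n : ℤ, 0 < ((n : ℝ) + α) * ((n : ℝ) + 2 * N + 1 - α) := by
          intro n
          have := sign_aux (n + N) _ ht0 ht1
          push_cast at this
          ring_nf at this ⊢
          exact this
        rcases lt_or_gt_of_ne hth with hlt | hgt
        · have hpos : ∀ n : ℤ, 0 < f n + f (e n) := by
            intro n
            rw [hg, sub_pos]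
            exact inv_pow_lt k ho _ _ (by linarith) (hsg n)
          exact ((hS.add he1).tsum_pos (fun n => (hpos n).le) 0 (hpos 0)).ne' hadd
        · have hpos : ∀ n : ℤ, 0 < -(f n + f (e n)) := by
            intro n
            rw [hg, neg_sub, sub_pos]
            exact inv_pow_lt k ho _ _ (by linarith) (by rw [mul_comm]; exact hsg n)
          refine ((hS.add he1).neg.tsum_pos (fun n => (hpos n).le) 0 (hpos 0)).ne' ?_
          rw [tsum_neg, hadd, neg_zero]
      · rintro ⟨_, m, hm⟩
        let e : ℤ ≃ ℤ := Equiv.subLeft (-1 - 2 * m)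
        have he2 : ∑' n, f (e n) = S := e.tsum_eq f
        have hneg : ∀ n, f (e n) = - f n := by
          intro n
          have h1 : ((e n : ℤ) : ℝ) + α = -((n : ℝ) + α) := by
            simp only [e, Equiv.subLeft_apply, hm]; push_cast; ring
          simp only [hf]
          rw [h1, ho.neg_pow, div_neg]
        simp_rw [hneg] at he2
        rw [tsum_neg] at he2
        change -S = S at he2
        linarith
end

section
/- For every even integer k > 1 and every rational α ∉ ℤ, the number \(\sum_{n=-\infty}^{+\infty} 1/(n+\alpha)^k\) is transcendental. -/
section
open Polynomial

theorem lind_core {ι : Type*} (T : Finset ι) (β : ι → ℂ) (k : ℕ) (hk : 0 < k) (f : ℤ[X])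
    (hf : f.eval 0 ≠ 0) (hr : ∀ i ∈ T, aeval (β i) f = 0) (c : ℤ) (hc : c ≠ 0)
    (hint : ∀ (g : ℤ[X]) (D : ℕ), g.natDegree ≤ D → ∃ z : ℤ, (c:ℂ)^D * ∑ i ∈ T, aeval (β i) g = z) :
    (k:ℂ) + ∑ i ∈ T, Complex.exp (β i) ≠ 0 := by
  intro h0
  obtain ⟨C, hC⟩ := LindemannWeierstrass.exp_polynomial_approx f hf
  set d := f.natDegree
  set A : ℝ := |(c:ℝ)|^d * |C| with hA
  have ht : Filter.Tendsto (fun n : ℕ => (T.card * A) * (A ^ n / (n.factorial : ℝ))) Filter.atTop (nhds 0) := by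
    simpa using (FloorSemiring.tendsto_pow_div_factorial_atTop A).const_mul (T.card * A)
  obtain ⟨N, hN⟩ := Filter.eventually_atTop.1 (ht.eventually (gt_mem_nhds zero_lt_one))
  obtain ⟨p, hpN, hp⟩ := Nat.exists_infinite_primes (N + 1 + (eval 0 f).natAbs + c.natAbs + k + 1)
  obtain ⟨n, hn, g, hg, hb⟩ := hC p (by omega) hp
  obtain ⟨z, hz⟩ := hint g (p * d) (hg.trans (Nat.sub_le _ _))
  have hf0 : f ≠ 0 := by rintro rfl; simp at hf
  have key : ((c^(p*d) * n * k + p * z : ℤ) : ℂ)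
      = - ((c:ℂ)^(p*d) * ∑ i ∈ T, (n • Complex.exp (β i) - p • aeval (β i) g)) := by
    have h1 : ∑ i ∈ T, Complex.exp (β i) = -(k:ℂ) := by linear_combination h0
    rw [Finset.sum_sub_distrib, ← Finset.smul_sum, ← Finset.smul_sum, h1]
    push_cast
    rw [← hz]
    simp only [zsmul_eq_mul, nsmul_eq_mul]
    ring
  have hbound : ‖((c^(p*d) * n * k + p * z : ℤ) : ℂ)‖ < 1 := by
    rw [key, norm_neg, norm_mul]
    have h2 : ‖∑ i ∈ T, (n • Complex.exp (β i) - p • aeval (β i) g)‖ ≤ T.card * (|C|^p / (p-1).factorial) := by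
      refine (norm_sum_le_of_le T (f := _) (n := fun _ => |C|^p / ((p-1).factorial:ℝ)) ?_).trans (by simp)
      intro i hi
      have := hb (r := β i) (by rw [mem_aroots]; exact ⟨hf0, hr i hi⟩)
      refine this.trans ?_
      gcongr ?_ / _
      rw [← abs_pow]; exact le_abs_self _
    refine (mul_le_mul_of_nonneg_left h2 (norm_nonneg _)).trans_lt ?_
    refine lt_of_eq_of_lt ?_ (hN (p-1) (by omega))
    have hpp : p = (p - 1) + 1 := by omega
    have e : ‖(c:ℂ)^(p*d)‖ = (|(c:ℝ)|^d)^p := by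
      rw [norm_pow, Complex.norm_intCast, ← pow_mul, mul_comm]
    rw [e]
    have : (|(c:ℝ)|^d)^p * |C|^p = A * A^(p-1) := by
      rw [← mul_pow, ← pow_succ', ← hpp]
    linear_combination (T.card / ((p-1).factorial : ℝ)) * this
  rw [Complex.norm_intCast] at hbound
  have hzero : c^(p*d) * n * k + p * z = 0 := by
    rw [← Int.abs_lt_one_iff]; exact_mod_cast hbound
  have hdvd : (p:ℤ) ∣ c^(p*d) * n * k := ⟨-z, by linear_combination hzero⟩
  have hpZ := Nat.prime_iff_prime_int.1 hp
  rcases hpZ.dvd_or_dvd hdvd with h | h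
  · rcases hpZ.dvd_or_dvd h with h | h
    · have h := hpZ.dvd_of_dvd_pow h
      have := Nat.le_of_dvd (Int.natAbs_pos.2 hc) (Int.natCast_dvd.1 h)
      omega
    · exact hn h
  · have := Nat.le_of_dvd hk (Int.natCast_dvd_natCast.1 h)
    omega

theorem pi_aux : ¬ IsAlgebraic ℚ ((Real.pi : ℂ) * Complex.I) := by
  intro hθ
  classical
  let K := algebraicClosure ℚ ℂ
  have : IsAlgClosure ℚ K := algebraicClosure.isAlgClosure ℚ ℂ
  have : IsGalois ℚ K := IsAlgClosure.isGalois ℚ K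
  let θ : K := ⟨(Real.pi : ℂ) * Complex.I, mem_algebraicClosure_iff.2 hθ⟩
  have hθi : IsIntegral ℚ θ := Algebra.IsIntegral.isIntegral θ
  let R : Finset K := ((minpoly ℚ θ).aroots K).toFinset
  have hmR : ∀ x, x ∈ R ↔ aeval x (minpoly ℚ θ) = 0 := by
    intro x
    simp [R, mem_aroots, minpoly.ne_zero hθi]
  have hσR : ∀ (σ : K ≃ₐ[ℚ] K) x, σ x ∈ R ↔ x ∈ R := by
    intro σ x
    have e : aeval (σ x) (minpoly ℚ θ) = σ (aeval x (minpoly ℚ θ)) :=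
      aeval_algHom_apply σ.toAlgHom x _
    rw [hmR, hmR, e, map_eq_zero_iff σ σ.injective]
  let T := R.powerset.filter (fun S => ∑ x ∈ S, x ≠ 0)
  let b : Finset K → K := fun S => ∑ x ∈ S, x
  have hTσ : ∀ (σ : K ≃ₐ[ℚ] K) S, S ∈ T → S.map σ.toEquiv.toEmbedding ∈ T := by
    intro σ S hS
    simp only [T, Finset.mem_filter, Finset.mem_powerset] at hS ⊢
    refine ⟨?_, ?_⟩
    · intro y hy
      obtain ⟨x, hx, rfl⟩ := Finset.mem_map.1 hy
      exact (hσR σ x).2 (hS.1 hx)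
    · rw [Finset.sum_map]
      have : ∑ x ∈ S, σ x ≠ 0 := by
        rw [← map_sum]; exact (map_ne_zero_iff σ σ.injective).2 hS.2
      exact this
  have hbσ : ∀ (σ : K ≃ₐ[ℚ] K) S, b (S.map σ.toEquiv.toEmbedding) = σ (b S) := by
    intro σ S
    simp only [b, Finset.sum_map, map_sum]; rfl
  have hfix : ∀ (σ : K ≃ₐ[ℚ] K) (G : K → K), (∀ x, σ (G x) = G (σ x)) →
      σ (∑ S ∈ T, G (b S)) = ∑ S ∈ T, G (b S) := by
    intro σ G hG
    rw [map_sum]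
    refine Finset.sum_bij' (fun S _ => S.map σ.toEquiv.toEmbedding)
      (fun S _ => S.map σ.symm.toEquiv.toEmbedding) (fun S hS => hTσ σ S hS)
      (fun S hS => hTσ σ.symm S hS) ?_ ?_ ?_
    · intro S _
      ext x; simp
    · intro S _
      ext x; simp
    · intro S _
      rw [hbσ, hG]
  have : Algebra.IsAlgebraic ℤ ℚ := IsLocalization.isAlgebraic ℚ (nonZeroDivisors ℤ)
  have : Algebra.IsAlgebraic ℤ K := Algebra.IsAlgebraic.trans ℤ ℚ K
  obtain ⟨c, hc, hci⟩ := Algebra.IsAlgebraic.exists_integral_multiples ℤ (T.image b)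
  have hq : ∀ S ∈ T, ∃ q : ℤ[X], q.coeff 0 ≠ 0 ∧ aeval (b S) q = 0 := by
    intro S hS
    exact (Algebra.IsAlgebraic.isAlgebraic (R := ℤ) (b S)).exists_nonzero_coeff_and_aeval_eq_zero
      (mem_nonZeroDivisors_of_ne_zero (Finset.mem_filter.1 hS).2)
  choose! q hq0 hqa using hq
  have hsum : ∑ S ∈ R.powerset, Complex.exp (b S : K) = 0 := by
    have : ∏ x ∈ R, (1 + Complex.exp (x : ℂ)) = 0 := by
      refine Finset.prod_eq_zero (i := θ) ((hmR _).2 (minpoly.aeval _ _)) ?_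
      simp [θ, Complex.exp_pi_mul_I]
    rw [Finset.prod_one_add] at this
    rw [← this]
    refine Finset.sum_congr rfl fun S _ => ?_
    rw [← Complex.exp_sum]
    simp [b]
  let k := (R.powerset.filter (fun S => ¬ (∑ x ∈ S, x ≠ 0))).card
  have hk : 0 < k := Finset.card_pos.2 ⟨∅, by simp⟩
  refine lind_core T (fun S => (b S : ℂ)) k hk (∏ S ∈ T, q S) ?_ ?_ c hc ?_ ?_
  · rw [eval_prod, Finset.prod_ne_zero_iff]
    intro S hS
    rw [← coeff_zero_eq_eval_zero]; exact hq0 S hS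
  · intro S hS
    rw [map_prod]
    refine Finset.prod_eq_zero hS ?_
    have := congrArg (algebraMap K ℂ) (hqa S hS)
    rw [← aeval_algebraMap_apply, map_zero] at this
    exact this
  · intro g D hD
    set y : K := (c:K)^D * ∑ S ∈ T, aeval (b S) g with hy
    have hyi : IsIntegral ℤ y := by
      rw [hy, Finset.mul_sum]
      refine IsIntegral.sum _ fun S hS => ?_
      rw [aeval_eq_sum_range, Finset.mul_sum]
      refine IsIntegral.sum _ fun i hi => ?_
      have hiD : i ≤ D := by have := Finset.mem_range.1 hi; omega
      have e : (c:K)^D * (g.coeff i • b S ^ i) = ((g.coeff i * c^(D-i) : ℤ) : K) * (c • b S)^i := by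
        rw [zsmul_eq_mul, zsmul_eq_mul, mul_pow, ← Nat.sub_add_cancel hiD, pow_add]
        simp only [Nat.add_sub_cancel]
        push_cast; ring
      rw [e]
      exact (isIntegral_algebraMap (R := ℤ) (A := K)).mul ((hci _ (Finset.mem_image_of_mem _ hS)).pow _)
    have hyf : y ∈ Set.range (algebraMap ℚ K) := by
      rw [InfiniteGalois.mem_range_algebraMap_iff_fixed]
      intro σ
      rw [hy, map_mul, map_pow, map_intCast]
      congr 1
      exact hfix σ (fun x => aeval x g) (fun x => by
        exact (aeval_algHom_apply (σ.toAlgHom.restrictScalars ℤ) x g).symm)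
    obtain ⟨r, hr⟩ := hyf
    rw [← hr, isIntegral_algebraMap_iff (algebraMap ℚ K).injective, IsIntegrallyClosed.isIntegral_iff] at hyi
    obtain ⟨z, hz⟩ := hyi
    refine ⟨z, ?_⟩
    have h1 : y = (z : K) := by rw [← hr, ← hz]; simp
    have h2 := congrArg (algebraMap K ℂ) h1
    rw [hy] at h2
    simp only [map_mul, map_pow, map_sum, map_intCast, ← aeval_algebraMap_apply] at h2
    exact h2
  · rw [← hsum, ← Finset.sum_filter_add_sum_filter_not R.powerset (fun S => ∑ x ∈ S, x ≠ 0), add_comm]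
    congr 1
    rw [Finset.sum_congr rfl (g := fun _ => (1:ℂ))]
    · simp [k]
    · intro S hS
      have : b S = 0 := by simpa using (Finset.mem_filter.1 hS).2
      simp [this]

theorem pi_tr : ¬ IsAlgebraic ℚ (Real.pi : ℂ) := by
  intro h
  refine pi_aux (h.mul ?_)
  exact ⟨X^2 + 1, by 
    intro h; have := congrArg (eval 0) h; simp at this, by simp⟩

theorem sum_form (k : ℕ) (hk : 2 ≤ k) (N : ℕ) (hN : 0 < N) (a : ℤ) (ha : ¬ (N:ℤ) ∣ a):
    ∃ A : ℂ, IsAlgebraic ℚ A ∧ HasSum (fun n : ℤ => 1 / ((n:ℂ) + (a:ℂ)/N)^k) ((Real.pi:ℂ)^k * A) := by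
  have hN0 : (N:ℂ) ≠ 0 := by exact_mod_cast hN.ne'
  set ζ := Complex.exp (2 * Real.pi * Complex.I / N) with hζ
  have hprim : IsPrimitiveRoot ζ N := Complex.isPrimitiveRoot_exp N hN.ne'
  have hζ0 : ζ ≠ 0 := Complex.exp_ne_zero _
  have hζa : IsAlgebraic ℚ ζ := (hprim.isIntegral hN).tower_top.isAlgebraic
  have hs : ∀ j ∈ Finset.range N, HasSum (fun m : ℤ => (ζ^(-a))^j * (1 / (m:ℂ)^k * (ζ^m)^j))
     ((ζ^(-a))^j * (-(2 * Real.pi * Complex.I) ^ k / k.factorial * (((Polynomial.bernoulli k).eval (j/N : ℚ) : ℚ):ℂ))) := by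
    intro j hj
    have hjN : (j:ℝ) ≤ N := by exact_mod_cast (Finset.mem_range.1 hj).le
    have hx : ((j:ℝ)/N) ∈ Set.Icc (0:ℝ) 1 := ⟨by positivity, div_le_one_of_le₀ hjN (by positivity)⟩
    have := hasSum_one_div_pow_mul_fourier_mul_bernoulliFun hk hx
    refine HasSum.mul_left _ ?_
    convert! this using 2 with m
    · congr 1
      rw [fourier_coe_apply, hζ, ← Complex.exp_int_mul, ← Complex.exp_nat_mul]
      congr 1
      push_cast; field_simp
    · rw [bernoulliFun]
      have : ((j:ℝ)/N) = algebraMap ℚ ℝ ((j:ℚ)/N) := by simp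
      rw [this, eval_map_algebraMap, aeval_algebraMap_apply]
      simp
  have hS := hasSum_sum hs
  have hterm : ∀ m : ℤ, ∑ j ∈ Finset.range N, (ζ^(-a))^j * (1 / (m:ℂ)^k * (ζ^m)^j)
      = if (N:ℤ) ∣ m - a then N * (1 / (m:ℂ)^k) else 0 := by
    intro m
    have : ∀ j, (ζ^(-a))^j * (1 / (m:ℂ)^k * (ζ^m)^j) = (1 / (m:ℂ)^k) * (ζ^(m-a))^j := by
      intro j
      rw [sub_eq_add_neg, zpow_add₀ hζ0, mul_pow]; ring
    simp_rw [this, ← Finset.mul_sum]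
    split_ifs with h
    · rw [(hprim.zpow_eq_one_iff_dvd _).2 h]; simp [mul_comm]
    · have h1 : ζ^(m-a) ≠ 1 := fun e => h ((hprim.zpow_eq_one_iff_dvd _).1 e)
      have h2 : (ζ^(m-a))^N = 1 := by
        rw [← zpow_natCast (ζ^(m-a)), ← zpow_mul, mul_comm, zpow_mul, zpow_natCast, hprim.pow_eq_one, one_zpow]
      rw [geom_sum_eq h1, h2]
      simp
  simp_rw [hterm] at hS
  have hinj : Function.Injective (fun n : ℤ => (N:ℤ) * n + a) := by
    intro x y h
    have : (N:ℤ) ≠ 0 := by exact_mod_cast hN.ne'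
    exact mul_left_cancel₀ this (add_right_cancel h)
  rw [← hinj.hasSum_iff] at hS
  · have hS2 := hS.mul_left ((N:ℂ)^k / N)
    refine ⟨(N:ℂ)^k / N * ∑ j ∈ Finset.range N, (ζ^(-a))^j * (-(2 * Complex.I) ^ k / k.factorial * (((Polynomial.bernoulli k).eval (j/N : ℚ) : ℚ):ℂ)), ?_, ?_⟩
    · have hI : IsAlgebraic ℚ Complex.I := ⟨X^2 + 1, by 
        intro h; have := congrArg (eval 0) h; simp at this, by simp⟩
      have hn : ∀ n : ℕ, IsAlgebraic ℚ (n:ℂ) := fun n => isAlgebraic_natCast n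
      have hr : ∀ n : ℚ, IsAlgebraic ℚ (n:ℂ) := fun n => isAlgebraic_algebraMap n
      have h2 : IsAlgebraic ℚ (2:ℂ) := by exact_mod_cast hn 2
      have hz : IsAlgebraic ℚ (ζ^(-a)) := by
        rw [← mem_algebraicClosure_iff] at hζa ⊢
        exact zpow_mem hζa _
      simp only [← mem_algebraicClosure_iff] at *
      refine mul_mem (div_mem (pow_mem (hn _) _) (hn _)) (sum_mem fun j _ => mul_mem (pow_mem hz _) (mul_mem (div_mem (neg_mem (pow_mem (mul_mem h2 hI) _)) (hn _)) (hr _)))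
    · have e1 : ∀ n : ℤ, 1 / ((n:ℂ) + (a:ℂ)/N)^k = (N:ℂ)^k / N * (((fun m : ℤ => if (N:ℤ) ∣ m - a then N * (1 / (m:ℂ)^k) else 0) ∘ fun n : ℤ => (N:ℤ) * n + a) n) := by
        intro n
        simp only [Function.comp]
        rw [if_pos (by simp)]
        have : ((n:ℂ) + a / N) = (((N:ℤ) * n + a : ℤ) : ℂ) / N := by
          push_cast; field_simp
        rw [this, div_pow]
        field_simp
      rw [funext e1]
      convert! hS2 using 1
      rw [mul_left_comm, Finset.mul_sum (a := (Real.pi:ℂ)^k)]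
      congr 1
      refine Finset.sum_congr rfl fun j _ => ?_
      rw [show (2 * (Real.pi:ℂ) * Complex.I) = Real.pi * (2 * Complex.I) by ring, mul_pow (Real.pi : ℂ)]
      ring
  · intro m hm
    rw [if_neg]
    rintro ⟨n, hn⟩
    exact hm ⟨n, by simp only; linarith⟩

end

theorem stmt_10 (k : ℕ) (hk : 1 < k) (hke : Even k) (α : ℚ) (hα : ¬ ∃ m : ℤ, α = m) :
    Transcendental ℚ (∑' n : ℤ, 1 / ((n : ℝ) + (α : ℝ))^k) := by
  have hd : (α.den : ℚ) ≠ 0 := by exact_mod_cast α.den_nz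
  obtain ⟨A, hA, hS⟩ := sum_form k hk α.den α.den_pos α.num (by
    rintro ⟨m, hm⟩
    apply hα
    refine ⟨m, ?_⟩
    rw [← Rat.num_div_den α, hm]
    push_cast; field_simp)
  have hα' : ((α.num : ℂ) / (α.den : ℂ)) = ((α : ℝ) : ℂ) := by
    have := Rat.num_div_den α
    rw [Complex.ofReal_ratCast]
    conv_rhs => rw [← this]
    push_cast; rfl
  rw [hα'] at hS
  have hS' : HasSum (fun n : ℤ => ((1 / ((n : ℝ) + (α : ℝ))^k : ℝ) : ℂ)) ((Real.pi:ℂ)^k * A) := by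
    convert hS using 2 with n
    push_cast; rfl
  have hsum : Summable (fun n : ℤ => 1 / ((n : ℝ) + (α : ℝ))^k) := Complex.summable_ofReal.1 hS'.summable
  set s := ∑' n : ℤ, 1 / ((n : ℝ) + (α : ℝ))^k with hs
  have hsA : (s : ℂ) = (Real.pi:ℂ)^k * A := by
    rw [hs, Complex.ofReal_tsum]; exact hS'.tsum_eq
  have hα0 : (α:ℝ) ≠ 0 := by
    intro h
    exact hα ⟨0, by exact_mod_cast h⟩
  have hpos : 0 < s := by
    refine hsum.tsum_pos (fun n => one_div_nonneg.2 (hke.pow_nonneg _)) 0 ?_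
    simpa using hke.pow_pos hα0
  intro halg
  have h1 : IsAlgebraic ℚ (s:ℂ) := halg.algebraMap (A := ℂ)
  have hA0 : A ≠ 0 := by
    rintro rfl
    rw [mul_zero] at hsA
    exact hpos.ne' (by exact_mod_cast hsA)
  have h2 : IsAlgebraic ℚ ((Real.pi:ℂ)^k) := by
    have : (Real.pi:ℂ)^k = s * A⁻¹ := by rw [hsA]; field_simp
    rw [this]
    exact h1.mul hA.inv
  exact pi_tr (h2.of_pow (by omega))
end

section
/- For every nonnegative integer m and every real z with 0 < |z| < 1, the 2m-th derivative of π·cot(πz) equals \((2m)!/z^{2m+1} - 2\sum_{n=m+1}^{\infty} \zeta(2n)\,(2n-1)(2n-2)\cdots(2n-2m)\, z^{2n-2m-1}\). -/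
noncomputable def zc (k : ℕ) : ℝ := ∑' n : ℕ, 1 / ((n : ℝ) + 1) ^ (2 * k + 2)

lemma zc_summable (k : ℕ) : Summable fun n : ℕ => 1 / ((n : ℝ) + 1) ^ (2 * k + 2) := by
  have h := (summable_nat_add_iff 1).mpr
    (Real.summable_one_div_nat_pow.mpr (by omega : 1 < 2 * k + 2))
  simpa using h

lemma zc_bound (k : ℕ) : |zc k| ≤ zc 0 := by
  have h0 : 0 ≤ zc k := tsum_nonneg fun n => by positivity
  rw [abs_of_nonneg h0]
  refine (zc_summable k).tsum_le_tsum (fun n => ?_) (zc_summable 0)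
  gcongr
  · simp
  · omega

lemma zeta_zc (k : ℕ) : riemannZeta (2 * ((k : ℂ) + 1)) = (zc k : ℂ) := by
  have h : (2 * ((k : ℂ) + 1)) = ((2 * k + 2 : ℕ) : ℂ) := by push_cast; ring
  rw [h, zeta_eq_tsum_one_div_nat_add_one_cpow, zc, Complex.ofReal_tsum]
  · refine tsum_congr fun n => ?_
    rw [Complex.cpow_natCast]
    push_cast
    rfl
  · rw [Complex.natCast_re]
    exact_mod_cast (by omega : 1 < 2 * k + 2)

noncomputable def pT (a : ℕ → ℝ) (j k : ℕ) (x : ℝ) : ℝ :=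
  a k * ((2 * k + 1).descFactorial j : ℝ) * x ^ (2 * k + 1 - j)

lemma pT_deriv (a : ℕ → ℝ) (j k : ℕ) (x : ℝ) :
    HasDerivAt (pT a j k) (pT a (j + 1) k x) x := by
  have h := (hasDerivAt_pow (2 * k + 1 - j) x).const_mul
    (a k * ((2 * k + 1).descFactorial j : ℝ))
  refine h.congr_deriv ?_
  rw [pT, Nat.descFactorial_succ, Nat.cast_mul, Nat.sub_sub]
  ring

lemma pT_bound (a : ℕ → ℝ) (C : ℝ) (ha : ∀ k, |a k| ≤ C) (j k : ℕ) (x r : ℝ) (hr : 0 < r)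
    (hx : |x| ≤ r) :
    ‖pT a j k x‖ ≤ C / r ^ j * (((2 * k + 1 : ℕ) : ℝ) ^ j * r ^ (2 * k + 1)) := by
  have hC : 0 ≤ C := (abs_nonneg _).trans (ha 0)
  rw [pT, Real.norm_eq_abs, abs_mul, abs_mul, abs_pow, Nat.abs_cast]
  by_cases hj : j ≤ 2 * k + 1
  · have h1 : r ^ (2 * k + 1) = r ^ (2 * k + 1 - j) * r ^ j := by
      rw [← pow_add]; congr 1; omega
    have h2 : C / r ^ j * (((2 * k + 1 : ℕ) : ℝ) ^ j * r ^ (2 * k + 1)) =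
        C * ((2 * k + 1 : ℕ) : ℝ) ^ j * r ^ (2 * k + 1 - j) := by
      rw [h1]; field_simp
    rw [h2]
    gcongr
    · exact ha k
    · exact_mod_cast Nat.descFactorial_le_pow _ _
  · rw [Nat.descFactorial_eq_zero_iff_lt.mpr (by omega)]
    simp only [Nat.cast_zero, mul_zero, zero_mul]
    positivity

lemma pT_bsum (C : ℝ) (j : ℕ) (r : ℝ) (hr : 0 < r) (hr1 : r < 1) :
    Summable fun k : ℕ => C / r ^ j * (((2 * k + 1 : ℕ) : ℝ) ^ j * r ^ (2 * k + 1)) := by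
  have h := summable_pow_mul_geometric_of_norm_lt_one j
    (show ‖r‖ < 1 by rwa [Real.norm_eq_abs, abs_of_pos hr])
  exact (h.comp_injective (i := fun k : ℕ => 2 * k + 1)
    (fun a b hab => by simp only at hab; omega)).mul_left _

lemma exists_r (x : ℝ) (hx : |x| < 1) : ∃ r : ℝ, 0 < r ∧ r < 1 ∧ |x| < r :=
  ⟨(|x| + 1) / 2, by positivity, by linarith, by linarith⟩

lemma pT_summable (a : ℕ → ℝ) (C : ℝ) (ha : ∀ k, |a k| ≤ C) (j : ℕ) (x : ℝ) (hx : |x| < 1) :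
    Summable fun k => pT a j k x := by
  obtain ⟨r, h0, h1, h2⟩ := exists_r x hx
  exact .of_norm_bounded (pT_bsum C j r h0 h1) fun k => pT_bound a C ha j k x r h0 h2.le

lemma pT_tsum_deriv (a : ℕ → ℝ) (C : ℝ) (ha : ∀ k, |a k| ≤ C) (j : ℕ) (x : ℝ) (hx : |x| < 1) :
    HasDerivAt (fun y => ∑' k, pT a j k y) (∑' k, pT a (j + 1) k x) x := by
  obtain ⟨r, h0, h1, h2⟩ := exists_r x hx
  have hm : x ∈ Metric.ball (0 : ℝ) r := by simpa using h2
  refine hasDerivAt_tsum_of_isPreconnected (pT_bsum C (j + 1) r h0 h1) Metric.isOpen_ball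
    (convex_ball 0 r).isPreconnected (fun n y _ => pT_deriv a j n y) (fun n y hy => ?_) hm
    (pT_summable a C ha j x hx) hm
  exact pT_bound a C ha (j + 1) n y r h0 (by simpa using (Metric.mem_ball.mp hy).le)

lemma cot_real (x : ℝ) (hx0 : x ≠ 0) (hx : |x| < 1) :
    Real.pi * Real.cot (Real.pi * x) = 1 / x - 2 * ∑' k, pT zc 0 k x := by
  have hmem : (x : ℂ) ∈ Complex.integerComplement := by
    rw [Complex.mem_integerComplement_iff]
    rintro ⟨n, hn⟩
    have hn' : (n : ℝ) = x := by exact_mod_cast hn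
    rw [← hn'] at hx hx0
    have : |n| < 1 := by exact_mod_cast hx
    rw [Int.abs_lt_one_iff] at this
    simp [this] at hx0
  have h := cot_series_rep' hmem
  have h' : Real.pi * Real.cot (Real.pi * x) - 1 / x =
      ∑' n : ℕ, (1 / (x - (n + 1)) + 1 / (x + (n + 1))) := by
    apply Complex.ofReal_injective
    rw [Complex.ofReal_tsum]
    push_cast
    exact h
  have habs := abs_lt.mp hx
  have hsq : x ^ 2 < 1 := by nlinarith
  have hterm : ∀ n : ℕ, HasSum
      (fun k : ℕ => (1 / ((n : ℝ) + 1) ^ (2 * k + 2)) * x ^ (2 * k + 1))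
      (x / (((n : ℝ) + 1) ^ 2 - x ^ 2)) := by
    intro n
    have hn : (1 : ℝ) ≤ ((n : ℝ) + 1) ^ 2 := by
      nlinarith [(Nat.cast_nonneg n : (0 : ℝ) ≤ n)]
    have hq : x ^ 2 / ((n : ℝ) + 1) ^ 2 < 1 := by
      rw [div_lt_one (by positivity)]; linarith
    have hg := (hasSum_geometric_of_lt_one (by positivity) hq).mul_left (x / ((n : ℝ) + 1) ^ 2)
    have hne : ((n : ℝ) + 1) ^ 2 - x ^ 2 ≠ 0 := by
      have : 0 < ((n : ℝ) + 1) ^ 2 - x ^ 2 := by linarith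
      exact this.ne'
    have hn0 : ((n : ℝ) + 1) ≠ 0 := by positivity
    have c1 : (fun k : ℕ => (1 / ((n : ℝ) + 1) ^ (2 * k + 2)) * x ^ (2 * k + 1)) =
        fun k : ℕ => x / ((n : ℝ) + 1) ^ 2 * (x ^ 2 / ((n : ℝ) + 1) ^ 2) ^ k := by
      funext k
      rw [div_pow, ← pow_mul, ← pow_mul, pow_add, pow_succ]
      field_simp
      ring
    have c2 : x / (((n : ℝ) + 1) ^ 2 - x ^ 2) =
        x / ((n : ℝ) + 1) ^ 2 * (1 - x ^ 2 / ((n : ℝ) + 1) ^ 2)⁻¹ := by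
      rw [one_sub_div (pow_ne_zero 2 hn0)]
      field_simp
    rw [c1, c2]
    exact hg
  have hd : Summable fun p : ℕ × ℕ =>
      (1 / ((p.1 : ℝ) + 1) ^ (2 * p.2 + 2)) * x ^ (2 * p.2 + 1) := by
    have hgeo : Summable fun k : ℕ => |x| ^ (2 * k + 1) := by
      have := (summable_geometric_of_lt_one (abs_nonneg x) hx).comp_injective
        (i := fun k : ℕ => 2 * k + 1) (fun a b hab => by simp only at hab; omega)
      exact this
    refine Summable.of_norm_bounded
      ((zc_summable 0).mul_of_nonneg hgeo (fun n => by positivity) (fun n => by positivity))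
      fun p => ?_
    rw [norm_mul, norm_pow, Real.norm_eq_abs, Real.norm_eq_abs,
      abs_of_nonneg (by positivity : 0 ≤ 1 / ((p.1 : ℝ) + 1) ^ (2 * p.2 + 2))]
    gcongr
    · simp
    · omega
  have hswap : ∑' n : ℕ, x / (((n : ℝ) + 1) ^ 2 - x ^ 2) = ∑' k, pT zc 0 k x := by
    calc _ = ∑' n : ℕ, ∑' k : ℕ, (1 / ((n : ℝ) + 1) ^ (2 * k + 2)) * x ^ (2 * k + 1) :=
          tsum_congr fun n => (hterm n).tsum_eq.symm
      _ = ∑' k : ℕ, ∑' n : ℕ, (1 / ((n : ℝ) + 1) ^ (2 * k + 2)) * x ^ (2 * k + 1) :=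
          Summable.tsum_comm (f := fun k n : ℕ =>
            (1 / ((n : ℝ) + 1) ^ (2 * k + 2)) * x ^ (2 * k + 1)) hd.prod_symm
      _ = _ := by
          refine tsum_congr fun k => ?_
          rw [tsum_mul_right]
          simp [pT, zc]
  have hneg : ∑' n : ℕ, (1 / (x - (n + 1)) + 1 / (x + (n + 1))) =
      -2 * ∑' n : ℕ, x / (((n : ℝ) + 1) ^ 2 - x ^ 2) := by
    rw [← tsum_mul_left]
    refine tsum_congr fun n => ?_
    have hn := (Nat.cast_nonneg n : (0 : ℝ) ≤ n)
    have e1 : x - (n + 1) ≠ 0 := by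
      have : x - (n + 1) < 0 := by linarith
      exact this.ne
    have e2 : x + (n + 1) ≠ 0 := by
      have : 0 < x + (n + 1) := by linarith
      exact this.ne'
    have e3 : ((n : ℝ) + 1) ^ 2 - x ^ 2 = -((x - (n + 1)) * (x + (n + 1))) := by ring
    rw [e3]
    field_simp
    ring
  rw [hneg, hswap] at h'
  linarith

lemma iter_cot (j : ℕ) : ∀ x : ℝ, x ≠ 0 → |x| < 1 →
    iteratedDeriv j (fun x : ℝ => Real.pi * Real.cot (Real.pi * x)) x =
      (-1) ^ j * (Nat.factorial j) / x ^ (j + 1) - 2 * ∑' k, pT zc j k x := by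
  induction j with
  | zero =>
    intro x h0 h1
    rw [iteratedDeriv_zero, cot_real x h0 h1]
    simp
  | succ j ih =>
    intro x h0 h1
    rw [iteratedDeriv_succ]
    have hev : iteratedDeriv j (fun x : ℝ => Real.pi * Real.cot (Real.pi * x)) =ᶠ[nhds x]
        fun x => (-1) ^ j * (Nat.factorial j) / x ^ (j + 1) - 2 * ∑' k, pT zc j k x := by
      have o1 : ∀ᶠ y in nhds x, y ≠ 0 := isOpen_ne.mem_nhds h0
      have o2 : ∀ᶠ y in nhds x, |y| < 1 := (isOpen_lt continuous_abs continuous_const).mem_nhds h1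
      filter_upwards [o1, o2] with y hy0 hy1 using ih y hy0 hy1
    rw [hev.deriv_eq]
    have hd1 := (hasDerivAt_const x ((-1 : ℝ) ^ j * (Nat.factorial j))).fun_div
      (hasDerivAt_pow (j + 1) x) (pow_ne_zero _ h0)
    have hd := hd1.fun_sub ((pT_tsum_deriv zc (zc 0) zc_bound j x h1).const_mul 2)
    rw [hd.deriv]
    congr 1
    rw [Nat.factorial_succ]
    push_cast
    field_simp
    simp
    ring

open Real in
theorem stmt_16 (m : ℕ) (z : ℝ) (hz0 : 0 < |z|) (hz1 : |z| < 1) :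
    iteratedDeriv (2*m) (fun x : ℝ => π * Real.cot (π * x)) z =
      (Nat.factorial (2*m)) / z^(2*m+1) -
        2 * ∑' n : ℕ, (riemannZeta (2 * (n + m + 1))).re *
          (∏ i ∈ Finset.range (2*m), ((2 * (n + m + 1) : ℝ) - 1 - i)) *
          z^(2 * (n + m + 1) - 2*m - 1) := by
  rw [iter_cot (2 * m) z (abs_pos.mp hz0) hz1]
  congr 1
  · simp
  congr 1
  rw [← (pT_summable zc (zc 0) zc_bound (2 * m) z hz1).sum_add_tsum_nat_add m,
    Finset.sum_eq_zero, zero_add]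
  · refine tsum_congr fun n => ?_
    have hz := zeta_zc (n + m)
    push_cast at hz
    rw [hz, Complex.ofReal_re, pT]
    congr 1
    · congr 1
      rw [Nat.descFactorial_eq_prod_range, Nat.cast_prod]
      refine Finset.prod_congr rfl fun i hi => ?_
      rw [Finset.mem_range] at hi
      rw [Nat.cast_sub (by omega)]
      push_cast
      ring
    · congr 1
      omega
  · intro k hk
    rw [Finset.mem_range] at hk
    rw [pT, Nat.descFactorial_eq_zero_iff_lt.mpr (by omega)]
    simp
end
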